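/- For p = 2 and any fixed odd positive integer k, E_{μ⊢n} (M_μ^{(k)})² = ((√6/(2π log 2))·√n·log n)²·(1 + o_k(1)) as n → ∞; consequently, Var(M_μ^{(k)}) = o((√n log n)²), and by Chebyshev's inequality, for all but an o(1)-proportion of partitions μ of n one has M_μ^{(k)} ≥ (1/log 2 − 1/100)·(√6/(2π))·√n·log n. -/

import Mathlib

open Real Filter
open scoped BigOperators

/-- `M_μ^{(k)}` (for `p = 2`): the sum of the parts of `μ` of the form `k·2^j`. -/
noncomputable def Msum (p k : ℕ) (s : Multiset ℕ) : ℕ :=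
  letI := Classical.decPred fun a : ℕ => ∃ j : ℕ, a = k * p ^ j
  (s.filter fun a : ℕ => ∃ j : ℕ, a = k * p ^ j).sum

/-- Uniform average over partitions of `n` of a real statistic. -/
noncomputable def pAvg (n : ℕ) (f : Nat.Partition n → ℝ) : ℝ :=
  (∑ μ : Nat.Partition n, f μ) / Nat.card (Nat.Partition n)

/-- `f (n - x)` extended by zero. -/
noncomputable def extz (f : ℕ → ℝ) (n x : ℕ) : ℝ := if x ≤ n then f (n - x) else 0

/-- partial sums -/
noncomputable def psum (f : ℕ → ℝ) (n : ℕ) : ℝ := ∑ m ∈ Finset.range (n + 1), f m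

lemma psum_succ (f : ℕ → ℝ) (n : ℕ) : psum f (n+1) = psum f n + f (n+1) := by
  unfold psum; rw [Finset.sum_range_succ]

lemma psum_zero (f : ℕ → ℝ) : psum f 0 = f 0 := by simp [psum]

lemma psum_nonneg {f : ℕ → ℝ} (hf : ∀ n, 0 ≤ f n) (n : ℕ) : 0 ≤ psum f n :=
  Finset.sum_nonneg fun i _ => hf i

lemma psum_mono {f : ℕ → ℝ} (hf : ∀ n, 0 ≤ f n) : Monotone (psum f) :=
  monotone_nat_of_le_succ fun n => by rw [psum_succ]; linarith [hf (n+1)]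

lemma le_psum {f : ℕ → ℝ} (hf : ∀ n, 0 ≤ f n) (n : ℕ) : f n ≤ psum f n := by
  cases n with
  | zero => rw [psum_zero]
  | succ n => rw [psum_succ]; linarith [psum_nonneg hf n]

lemma extz_nonneg {f : ℕ → ℝ} (hf : ∀ n, 0 ≤ f n) (n x : ℕ) : 0 ≤ extz f n x := by
  unfold extz; split_ifs; exacts [hf _, le_rfl]

lemma extz_anti {f : ℕ → ℝ} (hf : ∀ n, 0 ≤ f n) (hm : Monotone f) (n : ℕ) {x y : ℕ}
    (h : x ≤ y) : extz f n y ≤ extz f n x := by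
  unfold extz
  split_ifs with h1 h2
  · exact hm (by omega)
  · omega
  · exact hf _
  · exact le_rfl

lemma sum_extz (f : ℕ → ℝ) (n : ℕ) : ∑ x ∈ Finset.range (n+1), extz f n x = psum f n := by
  unfold psum
  rw [← Finset.sum_range_reflect]
  apply Finset.sum_congr rfl
  intro x hx
  have := Finset.mem_range.1 hx
  unfold extz
  rw [if_pos (by omega)]
  congr 1; omega

lemma sum_mul_extz (f : ℕ → ℝ) (n : ℕ) :
    ∑ x ∈ Finset.range (n+1), ((x:ℝ)+1) * extz f n x = psum (psum f) n := by
  induction n with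
  | zero => simp [psum, extz]
  | succ n ih =>
    rw [Finset.sum_range_succ', psum_succ, ← ih, psum_succ, ← sum_extz f n, add_comm _ (f (n+1)),
      add_comm (∑ x ∈ Finset.range (n+1), ((x:ℝ)+1) * extz f n x), add_assoc,
      ← Finset.sum_add_distrib, add_comm]
    congr 1
    · simp [extz]
    · apply Finset.sum_congr rfl
      intro x hx
      have := Finset.mem_range.1 hx
      have : extz f (n+1) (x+1) = extz f n x := by
        unfold extz
        rw [if_pos (by omega), if_pos (by omega)]; congr 1; omega
      rw [this]; push_cast; ring

lemma sum_range_le_supp (g : ℕ → ℝ) (n K : ℕ) (h0 : ∀ x, 0 ≤ g x) (hs : ∀ x, n < x → g x = 0) :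
    ∑ x ∈ Finset.range K, g x ≤ ∑ x ∈ Finset.range (n+1), g x := by
  rcases le_total K (n+1) with h | h
  · exact Finset.sum_le_sum_of_subset_of_nonneg (Finset.range_mono h) fun i _ _ => h0 i
  · apply le_of_eq
    symm
    apply Finset.sum_subset (Finset.range_mono h)
    intro x _ hx
    apply hs; simp at hx; omega

lemma extz_supp (f : ℕ → ℝ) {n x : ℕ} (h : n < x) : extz f n x = 0 := by
  unfold extz; rw [if_neg (by omega)]

lemma sum_block (g : ℕ → ℝ) (N a : ℕ) :
    ∑ x ∈ Finset.range (N * a), g x = ∑ r ∈ Finset.range N, ∑ i ∈ Finset.range a, g (r * a + i) := by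
  induction N with
  | zero => simp
  | succ N ih => rw [Nat.succ_mul, Finset.sum_range_add, ih, Finset.sum_range_succ]

section
variable {f : ℕ → ℝ}

lemma lemA (hf : ∀ n, 0 ≤ f n) (hm : Monotone f) (n N a : ℕ) :
    (a:ℝ) * ∑ r ∈ Finset.range N, extz f n ((r+1)*a) ≤ psum f n := by
  rw [← sum_extz]
  refine le_trans ?_ (sum_range_le_supp _ n (N*a) (extz_nonneg hf n) fun x hx => extz_supp f hx)
  rw [sum_block, Finset.mul_sum]
  apply Finset.sum_le_sum
  intro r _
  calc (a:ℝ) * extz f n ((r+1)*a) = ∑ i ∈ Finset.range a, extz f n ((r+1)*a) := by simp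
    _ ≤ _ := by
      apply Finset.sum_le_sum
      intro i hi
      have := Finset.mem_range.1 hi
      apply extz_anti hf hm
      nlinarith

lemma lemB (hf : ∀ n, 0 ≤ f n) (hm : Monotone f) (n N a : ℕ) :
    (a:ℝ)^2 * ∑ r ∈ Finset.range N, (2*(r:ℝ)+1) * extz f n ((r+1)*a) ≤ 2 * psum (psum f) n := by
  rw [← sum_mul_extz]
  refine le_trans ?_ (mul_le_mul_of_nonneg_left (sum_range_le_supp _ n (N*a)
    (fun x => mul_nonneg (by positivity) (extz_nonneg hf n x))
    fun x hx => by rw [extz_supp f hx, mul_zero]) (by norm_num))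
  rw [sum_block, Finset.mul_sum, Finset.mul_sum]
  apply Finset.sum_le_sum
  intro r _
  have key : ∀ a : ℕ, (a:ℝ)^2 ≤ ∑ i ∈ Finset.range a, 2 * ((i:ℝ)+1) := by
    intro a
    induction a with
    | zero => simp
    | succ a ih => rw [Finset.sum_range_succ]; push_cast; nlinarith
  have e0 := extz_nonneg hf n ((r+1)*a)
  calc (a:ℝ)^2 * ((2*(r:ℝ)+1) * extz f n ((r+1)*a))
      ≤ (∑ i ∈ Finset.range a, (2 * ((r * a + i : ℕ):ℝ) + 2)) * extz f n ((r+1)*a) := by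
        rw [← mul_assoc]
        apply mul_le_mul_of_nonneg_right _ e0
        have := key a
        have h2 : ∑ i ∈ Finset.range a, (2 * ((r * a + i : ℕ):ℝ) + 2)
          = (∑ i ∈ Finset.range a, 2 * ((i:ℝ)+1)) + a * (2 * r * a) := by
          have : (a:ℝ) * (2 * r * a) = ∑ i ∈ Finset.range a, (2 * (r:ℝ) * a) := by simp
          rw [this, ← Finset.sum_add_distrib]
          apply Finset.sum_congr rfl; intro i _; push_cast; ring
        rw [h2]; nlinarith
    _ ≤ _ := by
      rw [Finset.sum_mul, Finset.mul_sum]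
      apply Finset.sum_le_sum
      intro i hi
      have := Finset.mem_range.1 hi
      have h3 : extz f n ((r+1)*a) ≤ extz f n (r*a+i) := by
        apply extz_anti hf hm
        nlinarith
      have h4 : (0:ℝ) ≤ 2 * ((r * a + i : ℕ):ℝ) + 2 := by positivity
      calc _ ≤ (2 * ((r * a + i : ℕ):ℝ) + 2) * extz f n (r*a+i) :=
            mul_le_mul_of_nonneg_left h3 h4
        _ = _ := by ring

lemma lemC (hf : ∀ n, 0 ≤ f n) (hm : Monotone f) (n N a : ℕ) (ha : 0 < a) (hN : n ≤ N) :
    psum f n - a * f n ≤ (a:ℝ) * ∑ r ∈ Finset.range N, extz f n ((r+1)*a) := by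
  have h1 : psum f n ≤ ∑ x ∈ Finset.range ((N+1)*a), extz f n x := by
    rw [← sum_extz]
    exact Finset.sum_le_sum_of_subset_of_nonneg (Finset.range_mono (by nlinarith))
      fun i _ _ => extz_nonneg hf n i
  have h2 : ∑ x ∈ Finset.range ((N+1)*a), extz f n x ≤
      ∑ r ∈ Finset.range (N+1), a * extz f n (r*a) := by
    rw [sum_block]
    apply Finset.sum_le_sum
    intro r _
    calc _ ≤ ∑ i ∈ Finset.range a, extz f n (r*a) := by
          apply Finset.sum_le_sum
          intro i hi
          exact extz_anti hf hm n (by omega)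
      _ = _ := by simp
  rw [Finset.sum_range_succ', ← Finset.mul_sum] at h2
  have h3 : extz f n (0*a) = f n := by simp [extz]
  rw [h3] at h2
  linarith

lemma lemD_upper (hf : ∀ n, 0 ≤ f n) (hm : Monotone f) (n N r : ℕ) :
    (r:ℝ)^2 * ∑ a ∈ Finset.range N, ((a:ℝ)+1) * extz f n ((a+1)*r) ≤
      psum (psum f) n + r * psum f n := by
  have h1 := lemB hf hm n N r
  have h2 := lemA hf hm n N r
  have h3 : ∑ a ∈ Finset.range N, ((a:ℝ)+1) * extz f n ((a+1)*r) =
    (∑ a ∈ Finset.range N, (2*(a:ℝ)+1) * extz f n ((a+1)*r)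
      + ∑ a ∈ Finset.range N, extz f n ((a+1)*r)) / 2 := by
    rw [← Finset.sum_add_distrib, Finset.sum_div]
    apply Finset.sum_congr rfl; intro i _; ring
  rw [h3]
  have h4 : (0:ℝ) ≤ r * psum f n := mul_nonneg (by positivity) (psum_nonneg hf n)
  have h5 : (r:ℝ) * (r * ∑ a ∈ Finset.range N, extz f n ((a+1)*r)) ≤ r * psum f n :=
    mul_le_mul_of_nonneg_left h2 (by positivity)
  nlinarith

lemma lemD_lower (hf : ∀ n, 0 ≤ f n) (hm : Monotone f) (n N r : ℕ) (hr : 0 < r) (hN : n ≤ N) :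
    psum (psum f) n - (r + r^2) * psum f n ≤
    (r:ℝ)^2 * ∑ a ∈ Finset.range N, ((a:ℝ)+1) * extz f n ((a+1)*r) := by
  have h1 : psum (psum f) n ≤ ∑ x ∈ Finset.range ((N+1)*r), ((x:ℝ)+1) * extz f n x := by
    rw [← sum_mul_extz]
    exact Finset.sum_le_sum_of_subset_of_nonneg (Finset.range_mono (by nlinarith))
      fun i _ _ => mul_nonneg (by positivity) (extz_nonneg hf n i)
  have h2 : ∑ x ∈ Finset.range ((N+1)*r), ((x:ℝ)+1) * extz f n x ≤
      ∑ a ∈ Finset.range (N+1), (r:ℝ)^2 * (((a:ℝ)+1) * extz f n (a*r)) := by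
    rw [sum_block]
    apply Finset.sum_le_sum
    intro a _
    calc _ ≤ ∑ i ∈ Finset.range r, ((a:ℝ)+1)*r * extz f n (a*r) := by
          apply Finset.sum_le_sum
          intro i hi
          have := Finset.mem_range.1 hi
          apply mul_le_mul _ (extz_anti hf hm n (by omega)) (extz_nonneg hf n _) (by positivity)
          have : (i:ℝ) + 1 ≤ r := by exact_mod_cast this
          push_cast; nlinarith
      _ = _ := by simp; ring
  rw [← Finset.mul_sum, Finset.sum_range_succ'] at h2
  have h3 : extz f n (0*r) = f n := by simp [extz]
  rw [h3] at h2
  have h4 : ∑ a ∈ Finset.range N, (((a+1:ℕ):ℝ)+1) * extz f n ((a+1)*r) =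
     ∑ a ∈ Finset.range N, ((a:ℝ)+1) * extz f n ((a+1)*r) +
     ∑ a ∈ Finset.range N, extz f n ((a+1)*r) := by
    rw [← Finset.sum_add_distrib]
    apply Finset.sum_congr rfl; intro i _; push_cast; ring
  rw [h4] at h2
  have h5 := mul_le_mul_of_nonneg_left (lemA hf hm n N r) (show (0:ℝ) ≤ r by positivity)
  have h6 := mul_le_mul_of_nonneg_left (le_psum hf n) (show (0:ℝ) ≤ r^2 by positivity)
  push_cast at h2
  nlinarith

lemma sq_psum_le (hf : ∀ n, 0 ≤ f n) (hm : Monotone f) (n : ℕ) :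
    psum f n ^ 2 ≤ 2 * f n * psum (psum f) n := by
  induction n with
  | zero => simp only [psum_zero]; nlinarith [hf 0]
  | succ n ih =>
    rw [psum_succ (psum f), psum_succ]
    have := hm (Nat.le_succ n)
    have h2 : 0 ≤ psum (psum f) n := psum_nonneg (psum_nonneg hf) n
    have := hf (n+1)
    simp only [Nat.succ_eq_add_one] at *
    nlinarith [mul_nonneg h2 (sub_nonneg.2 ‹f n ≤ f (n+1)›)]

end

/-- number of partitions -/
noncomputable def pp (n : ℕ) : ℝ := (Fintype.card (Nat.Partition n) : ℝ)

open Classical in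
lemma card_ge (n : ℕ) (t : Multiset ℕ) (ht : ∀ x ∈ t, 0 < x) :
    ((Finset.univ.filter (fun μ : Nat.Partition n => t ≤ μ.parts)).card : ℝ)
      = extz pp n t.sum := by
  unfold extz
  split_ifs with h
  · unfold pp
    norm_cast
    rw [← Fintype.card_subtype]
    apply Fintype.card_congr
    refine ⟨fun μ => ⟨μ.1.parts - t, ?_, ?_⟩, fun ν => ⟨⟨ν.parts + t, ?_, ?_⟩, ?_⟩, ?_, ?_⟩
    · intro i hi
      exact μ.1.parts_pos (Multiset.mem_of_le (Multiset.sub_le_self _ _) hi)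
    · have h1 : (μ.1.parts - t) + t = μ.1.parts := Multiset.sub_add_cancel μ.2
      have h2 := congrArg Multiset.sum h1
      rw [Multiset.sum_add, μ.1.parts_sum] at h2
      omega
    · intro i hi
      rcases Multiset.mem_add.1 hi with hi | hi
      · exact ν.parts_pos hi
      · exact ht i hi
    · rw [Multiset.sum_add, ν.parts_sum]; omega
    · exact Multiset.le_add_left _ _
    · rintro ⟨μ, hμ⟩
      apply Subtype.ext
      apply Nat.Partition.ext
      exact Multiset.sub_add_cancel hμ
    · intro ν
      apply Nat.Partition.ext
      exact Multiset.add_sub_cancel_right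
  · norm_cast
    rw [Finset.card_eq_zero, Finset.filter_eq_empty_iff]
    intro μ _ hle
    have h1 : (μ.parts - t) + t = μ.parts := Multiset.sub_add_cancel hle
    have h2 := congrArg Multiset.sum h1
    rw [Multiset.sum_add, μ.parts_sum] at h2
    omega

lemma pp_pos (n : ℕ) : 1 ≤ pp n := by
  unfold pp
  have : 0 < Fintype.card (Nat.Partition n) := Fintype.card_pos
  exact_mod_cast this

lemma pp_nonneg (n : ℕ) : 0 ≤ pp n := by linarith [pp_pos n]

lemma pp_mono : Monotone pp := by
  classical
  apply monotone_nat_of_le_succ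
  intro n
  have := card_ge (n+1) {1} (by simp)
  simp only [extz, Multiset.sum_singleton] at this
  rw [if_pos (by omega), Nat.add_sub_cancel] at this
  rw [← this]
  unfold pp
  exact_mod_cast Finset.card_le_univ _

lemma sum_ind (m n : ℕ) (h : m ≤ n) (g : ℕ → ℝ) :
    ∑ r ∈ Finset.range n, (if r + 1 ≤ m then g r else 0) = ∑ r ∈ Finset.range m, g r := by
  rw [← Finset.sum_filter]
  congr 1
  ext r; simp; omega

lemma count_le_n {n : ℕ} (μ : Nat.Partition n) (a : ℕ) (ha : 0 < a) : μ.parts.count a ≤ n := by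
  have h1 : Multiset.replicate (μ.parts.count a) a ≤ μ.parts := Multiset.le_count_iff_replicate_le.1 le_rfl
  have h2 : (Multiset.replicate (μ.parts.count a) a).sum ≤ μ.parts.sum := by
    obtain ⟨t, ht⟩ := Multiset.le_iff_exists_add.1 h1
    have h3 := congrArg Multiset.sum ht
    rw [Multiset.sum_add] at h3
    omega
  rw [μ.parts_sum] at h2
  simp at h2
  nlinarith

open Classical in
lemma sum_weighted (n a : ℕ) (ha : 0 < a) (g : ℕ → ℝ) :
    ∑ μ : Nat.Partition n, ∑ r ∈ Finset.range (μ.parts.count a), g r =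
      ∑ r ∈ Finset.range n, g r * extz pp n ((r+1)*a) := by
  calc _ = ∑ μ : Nat.Partition n, ∑ r ∈ Finset.range n, (if r + 1 ≤ μ.parts.count a then g r else 0) :=
        Finset.sum_congr rfl fun μ _ => (sum_ind _ n (count_le_n μ a ha) g).symm
    _ = ∑ r ∈ Finset.range n, g r * extz pp n ((r+1)*a) := by
      rw [Finset.sum_comm]
      apply Finset.sum_congr rfl
      intro r _
      have := card_ge n (Multiset.replicate (r+1) a) (by
        intro x hx; rw [Multiset.eq_of_mem_replicate hx]; exact ha)
      simp only [Multiset.sum_replicate, smul_eq_mul, ← Multiset.le_count_iff_replicate_le] at this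
      rw [← this, ← Finset.sum_filter]
      simp [mul_comm]

lemma sum_count (n a : ℕ) (ha : 0 < a) :
    ∑ μ : Nat.Partition n, (μ.parts.count a : ℝ) = ∑ r ∈ Finset.range n, extz pp n ((r+1)*a) := by
  have := sum_weighted n a ha (fun _ => 1)
  simpa using this

lemma sum_count_sq (n a : ℕ) (ha : 0 < a) :
    ∑ μ : Nat.Partition n, (μ.parts.count a : ℝ)^2 =
      ∑ r ∈ Finset.range n, (2*(r:ℝ)+1) * extz pp n ((r+1)*a) := by
  rw [← sum_weighted n a ha (fun r => 2*(r:ℝ)+1)]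
  apply Finset.sum_congr rfl
  intro μ _
  induction μ.parts.count a with
  | zero => simp
  | succ m ih => rw [Finset.sum_range_succ, ← ih]; push_cast; ring

open Classical in
lemma sum_count_mul (n a b : ℕ) (ha : 0 < a) (hb : 0 < b) (hab : a ≠ b) :
    ∑ μ : Nat.Partition n, (μ.parts.count a : ℝ) * (μ.parts.count b : ℝ) =
      ∑ s ∈ Finset.range n, ∑ r ∈ Finset.range n, extz pp n ((r+1)*a + (s+1)*b) := by
  calc _ = ∑ μ : Nat.Partition n, ∑ s ∈ Finset.range n, ∑ r ∈ Finset.range n,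
        (if r + 1 ≤ μ.parts.count a ∧ s + 1 ≤ μ.parts.count b then (1:ℝ) else 0) := by
        apply Finset.sum_congr rfl
        intro μ _
        have h1 := sum_ind _ n (count_le_n μ a ha) (fun _ => 1)
        have h2 := sum_ind _ n (count_le_n μ b hb) (fun _ => 1)
        simp only [Finset.sum_const, Finset.card_range, nsmul_eq_mul, mul_one] at h1 h2
        rw [← h1, ← h2, Finset.sum_mul_sum, Finset.sum_comm]
        apply Finset.sum_congr rfl
        intro s _
        apply Finset.sum_congr rfl
        intro r _
        by_cases h : r + 1 ≤ μ.parts.count a <;> by_cases h' : s + 1 ≤ μ.parts.count b <;>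
          simp [h, h']
    _ = _ := by
      rw [Finset.sum_comm]
      apply Finset.sum_congr rfl
      intro s _
      rw [Finset.sum_comm]
      apply Finset.sum_congr rfl
      intro r _
      have := card_ge n (Multiset.replicate (r+1) a + Multiset.replicate (s+1) b) (by
        intro x hx
        rcases Multiset.mem_add.1 hx with hx | hx
        · rw [Multiset.eq_of_mem_replicate hx]; exact ha
        · rw [Multiset.eq_of_mem_replicate hx]; exact hb)
      simp only [Multiset.sum_add, Multiset.sum_replicate, smul_eq_mul] at this
      rw [← this, ← Finset.sum_filter]
      simp only [Finset.sum_const, nsmul_eq_mul, mul_one]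
      congr 2
      ext μ
      simp only [Finset.mem_filter, Finset.mem_univ, true_and]
      constructor
      · rintro ⟨h1, h2⟩
        rw [Multiset.le_iff_count]
        intro x
        rw [Multiset.count_add, Multiset.count_replicate, Multiset.count_replicate]
        split_ifs with h3 h4 h4
        · exact absurd (h3.trans h4.symm) hab
        · subst h3; simpa using h1
        · subst h4; simpa using h2
        · simp
      · intro h
        rw [Multiset.le_iff_count] at h
        have h1 := h a
        have h2 := h b
        rw [Multiset.count_add, Multiset.count_replicate, Multiset.count_replicate] at h1 h2
        simp [hab, hab.symm] at h1 h2
        exact ⟨h1, h2⟩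

lemma extz_add (f : ℕ → ℝ) (n x y : ℕ) :
    extz f n (x + y) = if y ≤ n then extz f (n - y) x else 0 := by
  unfold extz
  split_ifs <;> first | omega | rfl | (congr 1; omega)

lemma pair_bound1 (n a b : ℕ) (ha : 0 < a) (hb : 0 < b) (hab : a ≠ b) :
    ∑ μ : Nat.Partition n, ((a:ℝ) * μ.parts.count a) * (b * μ.parts.count b) ≤
      psum (psum pp) n := by
  have e : ∑ μ : Nat.Partition n, ((a:ℝ) * μ.parts.count a) * (b * μ.parts.count b)
     = b * ∑ s ∈ Finset.range n, (a * ∑ r ∈ Finset.range n, extz pp n ((r+1)*a + (s+1)*b)) := by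
    rw [← Finset.mul_sum, ← sum_count_mul n a b ha hb hab, Finset.mul_sum, Finset.mul_sum]
    apply Finset.sum_congr rfl; intro μ _; ring
  rw [e]
  refine le_trans ?_ (lemA (psum_nonneg pp_nonneg) (psum_mono pp_nonneg) n n b)
  apply mul_le_mul_of_nonneg_left _ (by positivity)
  apply Finset.sum_le_sum
  intro s _
  simp only [extz_add]
  unfold extz
  split_ifs
  · exact lemA pp_nonneg pp_mono _ n a
  · simp

lemma pair_bound2 (n a b : ℕ) (ha : 0 < a) (hb : 0 < b) (hab : a ≠ b) :
    ∑ μ : Nat.Partition n, ((a:ℝ) * μ.parts.count a) * (b * μ.parts.count b) ≤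
      2 / a * psum (psum (psum pp)) n := by
  have e : ∑ μ : Nat.Partition n, ((a:ℝ) * μ.parts.count a) * (b * μ.parts.count b)
     = b * ∑ s ∈ Finset.range n, (a * ∑ r ∈ Finset.range n, extz pp n ((r+1)*a + (s+1)*b)) := by
    rw [← Finset.mul_sum, ← sum_count_mul n a b ha hb hab, Finset.mul_sum, Finset.mul_sum]
    apply Finset.sum_congr rfl; intro μ _; ring
  have hp := psum_nonneg (psum_nonneg pp_nonneg)
  have ha' : (0:ℝ) < a := by exact_mod_cast ha
  rw [e]
  refine le_trans ?_ (mul_le_mul_of_nonneg_left (lemA hp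
    (psum_mono (psum_nonneg pp_nonneg)) n n b) (by positivity))
  rw [← mul_assoc, mul_comm (2/(a:ℝ)), mul_assoc]
  apply mul_le_mul_of_nonneg_left _ (by positivity)
  rw [Finset.mul_sum]
  apply Finset.sum_le_sum
  intro s _
  simp only [extz_add]
  by_cases h : (s+1)*b ≤ n
  · simp only [if_pos h]
    have h1 := lemB pp_nonneg pp_mono (n-(s+1)*b) n a
    have h2 : extz (psum (psum pp)) n ((s+1)*b) = psum (psum pp) (n-(s+1)*b) := by
      unfold extz; rw [if_pos h]
    rw [h2]
    have h3 : ∑ r ∈ Finset.range n, extz pp (n-(s+1)*b) ((r+1)*a) ≤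
      ∑ r ∈ Finset.range n, (2*(r:ℝ)+1) * extz pp (n-(s+1)*b) ((r+1)*a) := by
      apply Finset.sum_le_sum
      intro r _
      have := extz_nonneg pp_nonneg (n-(s+1)*b) ((r+1)*a)
      have : (0:ℝ) ≤ r := by positivity
      nlinarith
    have h4 := mul_le_mul_of_nonneg_left h3 (show (0:ℝ) ≤ a^2 by positivity)
    rw [div_mul_eq_mul_div, le_div_iff₀ ha']
    nlinarith
  · simp only [if_neg h]
    simp
    exact mul_nonneg (by positivity) (extz_nonneg hp _ _)

lemma diag_bound (n a : ℕ) (ha : 0 < a) :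
    ∑ μ : Nat.Partition n, ((a:ℝ) * μ.parts.count a) * (a * μ.parts.count a) ≤
      2 * psum (psum pp) n := by
  refine le_trans (le_of_eq ?_) (lemB pp_nonneg pp_mono n n a)
  rw [← sum_count_sq n a ha, Finset.mul_sum]
  apply Finset.sum_congr rfl; intro μ _; ring

lemma single_lower (n a : ℕ) (ha : 0 < a) :
    psum pp n - a * pp n ≤ ∑ μ : Nat.Partition n, ((a:ℝ) * μ.parts.count a) := by
  rw [← Finset.mul_sum, sum_count n a ha]
  exact lemC pp_nonneg pp_mono n n a ha le_rfl

lemma n_pp (n : ℕ) : (n:ℝ) * pp n =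
    ∑ r ∈ Finset.range n, ∑ a ∈ Finset.range n, ((a:ℝ)+1) * extz pp n ((a+1)*(r+1)) := by
  have h : ∀ μ : Nat.Partition n, (n:ℝ) = ∑ a ∈ Finset.range n, ((a:ℝ)+1) * μ.parts.count (a+1) := by
    intro μ
    have h1 : μ.parts.sum = ∑ a ∈ Finset.range n, (a+1) * μ.parts.count (a+1) := by
      rw [Finset.sum_multiset_count_of_subset μ.parts ((Finset.range n).image (· + 1))]
      · rw [Finset.sum_image (by intro a _ b _ h; simpa using h)]
        simp [mul_comm]
      · intro x hx
        have hx' := Multiset.mem_toFinset.1 hx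
        have := μ.parts_pos hx'
        have h2 : x ≤ n := by
          have := Multiset.le_sum_of_mem hx'
          rwa [μ.parts_sum] at this
        simp
        exact ⟨x-1, by omega, by omega⟩
    rw [μ.parts_sum] at h1
    exact_mod_cast h1
  have h2 : (n:ℝ) * pp n = ∑ μ : Nat.Partition n, (n:ℝ) := by simp [pp, mul_comm]
  rw [h2, Finset.sum_congr rfl (fun μ _ => h μ), Finset.sum_comm]
  conv_rhs => rw [Finset.sum_comm]
  apply Finset.sum_congr rfl
  intro a _
  rw [← Finset.mul_sum, sum_count n (a+1) (by omega), Finset.mul_sum]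
  apply Finset.sum_congr rfl
  intro r _
  rw [mul_comm (r+1)]

/-- cumulative sums of the partition function -/
noncomputable def vv : ℕ → ℝ := psum pp
/-- twice cumulative sums -/
noncomputable def uu : ℕ → ℝ := psum vv
/-- inner sums in the recurrence -/
noncomputable def TT (n r : ℕ) : ℝ :=
  ∑ a ∈ Finset.range n, ((a:ℝ)+1) * extz pp n ((a+1)*(r+1))

lemma vv_ge (n : ℕ) : 1 ≤ vv n := (pp_pos n).trans (le_psum pp_nonneg n)
lemma vv_nonneg (n : ℕ) : 0 ≤ vv n := by linarith [vv_ge n]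
lemma uu_ge (n : ℕ) : (n:ℝ) + 1 ≤ uu n := by
  induction n with
  | zero => rw [uu, psum_zero]; simpa using vv_ge 0
  | succ n ih =>
    rw [uu, psum_succ]
    have := vv_ge (n+1)
    rw [uu] at ih; push_cast; linarith
lemma uu_pos (n : ℕ) : 0 < uu n := by
  have := uu_ge n
  have : (0:ℝ) ≤ n := by positivity
  linarith
lemma uu_succ (n : ℕ) : uu (n+1) = uu n + vv (n+1) := psum_succ _ _
lemma vv_succ (n : ℕ) : vv (n+1) = vv n + pp (n+1) := psum_succ _ _

lemma TT_nonneg (n r : ℕ) : 0 ≤ TT n r :=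
  Finset.sum_nonneg fun a _ => mul_nonneg (by positivity) (extz_nonneg pp_nonneg _ _)

lemma TT_le (n r : ℕ) : TT n r / uu n ≤ 2 * (1 / ((r:ℝ)+1)^2) := by
  have h1 := lemB pp_nonneg pp_mono n n (r+1)
  have h2 : TT n r ≤ ∑ a ∈ Finset.range n, (2*(a:ℝ)+1) * extz pp n ((a+1)*(r+1)) := by
    apply Finset.sum_le_sum
    intro a _
    apply mul_le_mul_of_nonneg_right _ (extz_nonneg pp_nonneg _ _)
    have : (0:ℝ) ≤ a := by positivity
    linarith
  have h3 := mul_le_mul_of_nonneg_left h2 (show (0:ℝ) ≤ ((r:ℝ)+1)^2 by positivity)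
  push_cast at h1
  have h4 : ((r:ℝ)+1)^2 * TT n r ≤ 2 * uu n := h3.trans h1
  rw [div_le_iff₀ (uu_pos n), mul_one_div, div_mul_eq_mul_div, le_div_iff₀ (by positivity)]
  linarith

lemma hasSum_sh : HasSum (fun r : ℕ => 1 / ((r:ℝ)+1)^2) (π^2/6) := by
  have := (hasSum_nat_add_iff' 1).2 hasSum_zeta_two
  simpa using this

lemma n_pp_div (n : ℕ) : (n:ℝ) * pp n / uu n = ∑ r ∈ Finset.range n, TT n r / uu n := by
  rw [n_pp, Finset.sum_div]; rfl

lemma n_pp_le (n : ℕ) : (n:ℝ) * pp n / uu n ≤ 2 * (π^2/6) := by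
  rw [n_pp_div]
  refine (Finset.sum_le_sum fun r _ => TT_le n r).trans ?_
  rw [← Finset.mul_sum]
  apply mul_le_mul_of_nonneg_left _ (by norm_num)
  exact sum_le_hasSum _ (fun i _ => by positivity) hasSum_sh

lemma vv_div_uu_nonneg (n : ℕ) : 0 ≤ vv n / uu n := div_nonneg (vv_nonneg n) (uu_pos n).le

lemma vv_div_uu : Tendsto (fun n => vv n / uu n) atTop (nhds 0) := by
  have h1 : Tendsto (fun n : ℕ => Real.sqrt ((4 * (π^2/6)) / n)) atTop (nhds 0) := by
    have := (tendsto_const_div_atTop_nhds_zero_nat (4 * (π^2/6))).sqrt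
    simpa using this
  refine squeeze_zero' (Eventually.of_forall vv_div_uu_nonneg) ?_ h1
  filter_upwards [eventually_gt_atTop 0] with n hn
  have hn' : (0:ℝ) < n := by exact_mod_cast hn
  apply Real.le_sqrt_of_sq_le
  have h2 : vv n ^ 2 ≤ 2 * pp n * uu n := sq_psum_le pp_nonneg pp_mono n
  have h3 := n_pp_le n
  have hu := uu_pos n
  rw [div_le_iff₀ hu] at h3
  rw [div_pow, div_le_div_iff₀ (by positivity) hn']
  calc vv n ^ 2 * n ≤ 2 * pp n * uu n * n := by gcongr
    _ = 2 * uu n * (n * pp n) := by ring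
    _ ≤ 2 * uu n * (2 * (π^2/6) * uu n) := by gcongr
    _ = _ := by ring

lemma TT_tendsto (r : ℕ) : Tendsto (fun n => TT n r / uu n) atTop (nhds (1 / ((r:ℝ)+1)^2)) := by
  have hr : (0:ℝ) < (r:ℝ)+1 := by positivity
  have hlo : Tendsto (fun n => (1 - (((r:ℝ)+1) + ((r:ℝ)+1)^2) * (vv n / uu n)) * (1 / ((r:ℝ)+1)^2))
      atTop (nhds (1 / ((r:ℝ)+1)^2)) := by
    have := ((tendsto_const_nhds (x := (1:ℝ))).sub
      (vv_div_uu.const_mul (((r:ℝ)+1) + ((r:ℝ)+1)^2))).mul_const (1 / ((r:ℝ)+1)^2)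
    simpa using this
  have hhi : Tendsto (fun n => (1 + ((r:ℝ)+1) * (vv n / uu n)) * (1 / ((r:ℝ)+1)^2))
      atTop (nhds (1 / ((r:ℝ)+1)^2)) := by
    have := ((tendsto_const_nhds (x := (1:ℝ))).add
      (vv_div_uu.const_mul ((r:ℝ)+1))).mul_const (1 / ((r:ℝ)+1)^2)
    simpa using this
  refine tendsto_of_tendsto_of_tendsto_of_le_of_le hlo hhi ?_ ?_
  · intro n
    have hu := uu_pos n
    have h := lemD_lower pp_nonneg pp_mono n n (r+1) (by omega) le_rfl
    push_cast at h
    change uu n - ((r:ℝ) + 1 + ((r:ℝ)+1)^2) * vv n ≤ ((r:ℝ)+1)^2 * TT n r at h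
    simp only
    rw [mul_one_div, div_le_div_iff₀ (by positivity) hu]
    calc _ = uu n - ((r:ℝ) + 1 + ((r:ℝ)+1)^2) * vv n := by field_simp
      _ ≤ _ := by linarith
  · intro n
    have hu := uu_pos n
    have h := lemD_upper pp_nonneg pp_mono n n (r+1)
    push_cast at h
    change ((r:ℝ)+1)^2 * TT n r ≤ uu n + ((r:ℝ) + 1) * vv n at h
    simp only
    rw [mul_one_div, div_le_div_iff₀ hu (by positivity)]
    calc _ = ((r:ℝ)+1)^2 * TT n r := by ring
      _ ≤ _ := h
      _ = _ := by field_simp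

lemma n_pp_tendsto : Tendsto (fun n : ℕ => (n:ℝ) * pp n / uu n) atTop (nhds (π^2/6)) := by
  have h1 : ∀ n : ℕ, (n:ℝ) * pp n / uu n = ∑' r, (if r < n then TT n r / uu n else 0) := by
    intro n
    rw [n_pp_div, tsum_eq_sum (s := Finset.range n)]
    · apply Finset.sum_congr rfl
      intro r hr
      rw [if_pos (Finset.mem_range.1 hr)]
    · intro r hr
      rw [if_neg (by simpa using hr)]
  simp only [h1]
  rw [← hasSum_sh.tsum_eq]
  apply tendsto_tsum_of_dominated_convergence (bound := fun r : ℕ => 2 * (1 / ((r:ℝ)+1)^2))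
  · exact hasSum_sh.summable.mul_left 2
  · intro r
    apply (TT_tendsto r).congr'
    filter_upwards [eventually_gt_atTop r] with n hn
    rw [if_pos hn]
  · apply Eventually.of_forall
    intro n r
    split_ifs
    · rw [Real.norm_of_nonneg (div_nonneg (TT_nonneg n r) (uu_pos n).le)]
      exact TT_le n r
    · simp; positivity

lemma cc_pos : 0 < π^2/6 := by positivity

lemma uu_ratio : Tendsto (fun n => uu n / uu (n+1)) atTop (nhds 1) := by
  have h := (tendsto_const_nhds (x := (1:ℝ))).sub (vv_div_uu.comp (tendsto_add_atTop_nat 1))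
  rw [sub_zero] at h
  apply h.congr
  intro n
  have := uu_pos (n+1)
  simp only [Function.comp]
  rw [eq_div_iff this.ne', sub_mul, div_mul_cancel₀ _ this.ne', uu_succ]; ring

lemma inv_alpha : Tendsto (fun n : ℕ => uu n / ((n:ℝ) * pp n)) atTop (nhds (π^2/6)⁻¹) := by
  apply (n_pp_tendsto.inv₀ cc_pos.ne').congr
  intro n; rw [inv_div]

lemma succ_ratio : Tendsto (fun n : ℕ => ((n:ℝ)+1)/n) atTop (nhds 1) := by
  have := (tendsto_const_nhds (x := (1:ℝ))).add (tendsto_const_div_atTop_nhds_zero_nat (1:ℝ))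
  rw [add_zero] at this
  apply this.congr'
  filter_upwards [eventually_gt_atTop 0] with n hn
  have hn' : (0:ℝ) < n := by exact_mod_cast hn
  field_simp

lemma pp_ratio : Tendsto (fun n => pp n / pp (n+1)) atTop (nhds 1) := by
  have h := ((n_pp_tendsto.mul uu_ratio).mul (inv_alpha.comp (tendsto_add_atTop_nat 1))).mul succ_ratio
  have e : π^2/6 * 1 * (π^2/6)⁻¹ * 1 = 1 := by field_simp
  rw [e] at h
  apply h.congr'
  filter_upwards [eventually_gt_atTop 0] with n hn
  have hn' : (0:ℝ) < n := by exact_mod_cast hn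
  have := uu_pos (n+1)
  have := uu_pos n
  have := pp_pos (n+1)
  have h2 : (0:ℝ) < pp (n+1) := by linarith
  simp only [Function.comp]
  push_cast
  field_simp

lemma vv_div_pp_aux (H : ℕ) : ∀ᶠ n in atTop, (H:ℝ)/2 ≤ vv n / pp n := by
  induction H with
  | zero =>
    apply Eventually.of_forall; intro n
    simp; exact div_nonneg (vv_nonneg n) (pp_nonneg n)
  | succ H ih =>
    have h1 : Tendsto (fun n => 1 + pp n / pp (n+1) * ((H:ℝ)/2)) atTop (nhds (1 + 1 * ((H:ℝ)/2))) :=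
      (pp_ratio.mul_const _).const_add 1
    have h2 := h1.eventually (eventually_ge_nhds (show ((H:ℝ)+1)/2 < 1 + 1 * ((H:ℝ)/2) by linarith))
    have h3 : ∀ᶠ n in atTop, ((H+1:ℕ):ℝ)/2 ≤ vv (n+1) / pp (n+1) := by
      filter_upwards [h2, ih] with n h2 h3
      have a1 : 0 < pp (n+1) := by linarith [pp_pos (n+1)]
      have a2 : 0 < pp n := by linarith [pp_pos n]
      have e : vv (n+1) / pp (n+1) = 1 + pp n / pp (n+1) * (vv n / pp n) := by
        rw [vv_succ]; field_simp; ring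
      rw [e]
      push_cast
      have := mul_le_mul_of_nonneg_left h3 (show 0 ≤ pp n / pp (n+1) by positivity)
      linarith
    obtain ⟨N, hN⟩ := eventually_atTop.1 h3
    filter_upwards [eventually_ge_atTop (N+1)] with n hn
    have := hN (n-1) (by omega)
    rwa [Nat.sub_add_cancel (by omega)] at this

lemma pp_div_vv : Tendsto (fun n => pp n / vv n) atTop (nhds 0) := by
  have h : Tendsto (fun n => vv n / pp n) atTop atTop := by
    rw [tendsto_atTop]
    intro b
    obtain ⟨H, hH⟩ := exists_nat_ge (2*b)
    filter_upwards [vv_div_pp_aux H] with n hn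
    linarith
  apply h.inv_tendsto_atTop.congr
  intro n; simp [inv_div]

lemma sum_ratio {f g : ℕ → ℝ} (hg : ∀ n, 2 ≤ g n) {c : ℝ}
    (h : Tendsto (fun n => f n / g n) atTop (nhds c)) :
    Tendsto (fun n => (∑ i ∈ Finset.range n, f i) / (∑ i ∈ Finset.range n, g i)) atTop (nhds c) := by
  have hG : Tendsto (fun n => ∑ i ∈ Finset.range n, g i) atTop atTop := by
    apply tendsto_atTop_mono (f := fun n : ℕ => (n:ℝ)) _ tendsto_natCast_atTop_atTop
    intro n
    calc (n:ℝ) = ∑ i ∈ Finset.range n, (1:ℝ) := by simp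
      _ ≤ _ := Finset.sum_le_sum fun i _ => by linarith [hg i]
  have ho : (fun n => f n - c * g n) =o[atTop] g := by
    rw [Asymptotics.isLittleO_iff_tendsto (fun n hn => by linarith [hg n])]
    have := h.sub_const c
    rw [sub_self] at this
    apply this.congr
    intro n
    have : g n ≠ 0 := by linarith [hg n]
    field_simp
  have hs := ho.sum_range (fun n => by simpa using (by linarith [hg n] : 0 ≤ g n)) hG
  have hs2 := hs.tendsto_div_nhds_zero.add_const c
  rw [zero_add] at hs2
  apply hs2.congr'
  filter_upwards [hG.eventually_gt_atTop 0] with n hn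
  rw [Finset.sum_sub_distrib, ← Finset.mul_sum]
  field_simp
  ring

lemma key_sq : Tendsto (fun n : ℕ => (n:ℝ) * (vv n / uu n)^2) atTop (nhds (π^2/6)) := by
  set g : ℕ → ℝ := fun n => 2 * uu (n+1) * vv (n+1) / ((n:ℝ)+1) with hgdef
  have hg : ∀ n, 2 ≤ g n := by
    intro n
    have h1 := uu_ge (n+1)
    have h2 := vv_ge (n+1)
    simp only [hgdef]
    rw [le_div_iff₀ (by positivity)]
    push_cast at h1
    have : (0:ℝ) ≤ n := by positivity
    nlinarith
  have sh := tendsto_add_atTop_nat 1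
  have h1 : Tendsto (fun n => (vv (n+1)^2 - vv n^2) / g n) atTop (nhds (π^2/6)) := by
    have h := (n_pp_tendsto.comp sh).mul
      ((tendsto_const_nhds (x := (1:ℝ))).sub ((pp_div_vv.comp sh).mul_const (1/2)))
    rw [zero_mul, sub_zero, mul_one] at h
    apply h.congr
    intro n
    have a1 := uu_pos (n+1)
    have a2 : 0 < vv (n+1) := by linarith [vv_ge (n+1)]
    have a3 : vv n = vv (n+1) - pp (n+1) := by rw [vv_succ]; ring
    simp only [hgdef, Function.comp]
    rw [a3]
    push_cast
    field_simp
    ring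
  have h2 : Tendsto (fun n : ℕ => (uu (n+1)^2/((n+1:ℕ):ℝ) - uu n^2/(n:ℝ)) / g n) atTop (nhds 1) := by
    have h := ((uu_ratio.const_add 1).mul_const (1/2)).sub
      ((((uu_ratio.pow 2).mul (inv_alpha.comp sh)).mul (pp_div_vv.comp sh)).mul
        (succ_ratio.mul_const (1/2)))
    have e : (1 + 1) * (1 / 2) - 1 ^ 2 * (π ^ 2 / 6)⁻¹ * 0 * (1 * (1 / 2)) = (1:ℝ) := by norm_num
    rw [e] at h
    apply h.congr'
    filter_upwards [eventually_gt_atTop 0] with n hn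
    have hn' : (0:ℝ) < n := by exact_mod_cast hn
    have a1 := uu_pos (n+1)
    have a2 : 0 < vv (n+1) := by linarith [vv_ge (n+1)]
    have a4 : 0 < pp (n+1) := by linarith [pp_pos (n+1)]
    have a3 : vv (n+1) = uu (n+1) - uu n := by rw [uu_succ]; ring
    simp only [hgdef, Function.comp]
    push_cast
    have e2 : uu (n+1)^2/((n:ℝ)+1) - uu n^2/(n:ℝ) =
      (uu (n+1) + uu n) * vv (n+1) / ((n:ℝ)+1) - uu n^2/((n:ℝ)*((n:ℝ)+1)) := by
      rw [a3]; field_simp; ring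
    rw [e2]
    field_simp
  have s1 := sum_ratio hg h1
  have s2 := sum_ratio hg h2
  simp only [Finset.sum_range_sub (fun n => vv n ^ 2)] at s1
  simp only [Finset.sum_range_sub (fun n : ℕ => uu n ^ 2 / (n:ℝ))] at s2
  have hG : Tendsto (fun n => ∑ i ∈ Finset.range n, g i) atTop atTop := by
    apply tendsto_atTop_mono (f := fun n : ℕ => (n:ℝ)) _ tendsto_natCast_atTop_atTop
    intro n
    calc (n:ℝ) = ∑ i ∈ Finset.range n, (1:ℝ) := by simp
      _ ≤ _ := Finset.sum_le_sum fun i _ => by linarith [hg i]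
  have s3 := (s1.add (hG.inv_tendsto_atTop.const_mul (vv 0 ^ 2))).div s2 one_ne_zero
  rw [mul_zero, add_zero, div_one] at s3
  apply s3.congr'
  filter_upwards [hG.eventually_gt_atTop 0, eventually_gt_atTop 0] with n hn h0
  have hn' : (0:ℝ) < n := by exact_mod_cast h0
  have a1 := uu_pos n
  simp
  field_simp
  ring

lemma key : Tendsto (fun n : ℕ => Real.sqrt n * (vv n / uu n)) atTop (nhds (π / Real.sqrt 6)) := by
  have h := key_sq.sqrt
  rw [Real.sqrt_div (by positivity), Real.sqrt_sq (by positivity)] at h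
  apply h.congr
  intro n
  rw [Real.sqrt_mul (by positivity), Real.sqrt_sq (vv_div_uu_nonneg n)]

lemma vv_pp : Tendsto (fun n : ℕ => vv n / (pp n * Real.sqrt n)) atTop (nhds (Real.sqrt 6 / π)) := by
  have h := key.mul inv_alpha
  have e : π / Real.sqrt 6 * (π^2/6)⁻¹ = Real.sqrt 6 / π := by
    have : Real.sqrt 6 ^ 2 = 6 := Real.sq_sqrt (by norm_num)
    have : Real.sqrt 6 ≠ 0 := by positivity
    field_simp
    linarith
  rw [e] at h
  apply h.congr'
  filter_upwards [eventually_gt_atTop 0] with n hn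
  have hn' : (0:ℝ) < n := by exact_mod_cast hn
  have a1 := uu_pos n
  have a4 : 0 < pp n := by linarith [pp_pos n]
  have a5 : 0 < Real.sqrt n := Real.sqrt_pos.2 hn'
  have a6 : Real.sqrt n ^ 2 = n := Real.sq_sqrt hn'.le
  field_simp
  rw [a6]
  ring

lemma uu_le : ∃ C : ℝ, 0 ≤ C ∧ ∀ n : ℕ, uu n ≤ C * (Real.sqrt n + 1) * vv n := by
  have h := (key.add vv_div_uu).inv₀ (by positivity)
  obtain ⟨C, hC⟩ := h.bddAbove_range
  refine ⟨max C 0, le_max_right _ _, fun n => ?_⟩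
  have h1 := hC (Set.mem_range_self n)
  have a1 := uu_pos n
  have a2 : 0 < vv n := by linarith [vv_ge n]
  have a5 : 0 ≤ Real.sqrt n := Real.sqrt_nonneg _
  have e : (Real.sqrt n * (vv n / uu n) + vv n / uu n)⁻¹ = uu n / ((Real.sqrt n + 1) * vv n) := by
    field_simp
  simp only [e] at h1
  have h2 := h1.trans (le_max_left C 0)
  rw [div_le_iff₀ (by positivity)] at h2
  linarith

lemma zz_le : ∃ C : ℝ, 0 ≤ C ∧ ∀ n : ℕ, psum uu n ≤ C * (Real.sqrt n + 1) * uu n := by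
  obtain ⟨C, hC0, hC⟩ := uu_le
  refine ⟨C, hC0, fun n => ?_⟩
  unfold psum
  rw [show uu n = ∑ m ∈ Finset.range (n+1), vv m from rfl, Finset.mul_sum]
  apply Finset.sum_le_sum
  intro m hm
  refine (hC m).trans ?_
  have := Finset.mem_range.1 hm
  have h : Real.sqrt m ≤ Real.sqrt n := Real.sqrt_le_sqrt (by exact_mod_cast (by omega : m ≤ n))
  have := vv_nonneg m
  gcongr

lemma Msum_eq (k : ℕ) (hk0 : 0 < k) (n J : ℕ) (hJ : n < 2^J) (μ : Nat.Partition n) :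
    (Msum 2 k μ.parts : ℝ) = ∑ j ∈ Finset.range J,
      (((k*2^j : ℕ) : ℝ) * μ.parts.count (k*2^j)) := by
  have h : Msum 2 k μ.parts = ∑ j ∈ Finset.range J, (k*2^j) * μ.parts.count (k*2^j) := by
    unfold Msum
    classical
    rw [Finset.sum_multiset_count_of_subset _ ((Finset.range J).image (fun j => k*2^j))]
    · rw [Finset.sum_image]
      · apply Finset.sum_congr rfl
        intro j _
        rw [Multiset.count_filter, if_pos ⟨j, rfl⟩, smul_eq_mul, mul_comm]
      · intro a _ b _ hab
        have h1 : 2^a = 2^b := Nat.eq_of_mul_eq_mul_left hk0 hab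
        exact Nat.pow_right_injective le_rfl h1
    · intro x hx
      have hx' := Multiset.mem_toFinset.1 hx
      obtain ⟨hx1, j, rfl⟩ := Multiset.mem_filter.1 hx'
      have h2 : k*2^j ≤ n := Nat.Partition.le_of_mem_parts hx1
      rw [Finset.mem_image]
      refine ⟨j, ?_, rfl⟩
      rw [Finset.mem_range]
      by_contra hj
      have : 2^J ≤ 2^j := Nat.pow_le_pow_right (by norm_num) (by omega)
      nlinarith
  rw [h]; push_cast; rfl

lemma geom_tail (L m : ℕ) :
    ∑ j ∈ Finset.range (L+m), (if L ≤ j then (2:ℝ)/2^j else 0) ≤ 4/2^L := by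
  have h : ∑ j ∈ Finset.range (L+m), (if L ≤ j then (2:ℝ)/2^j else 0) = (4 - 4/2^m)/2^L := by
    induction m with
    | zero =>
      simp only [add_zero, pow_zero, div_one, sub_self, zero_div]
      apply Finset.sum_eq_zero
      intro x hx
      have := Finset.mem_range.1 hx
      rw [if_neg (by omega)]
    | succ m ih =>
      rw [← add_assoc, Finset.sum_range_succ, ih, if_pos (by omega)]
      rw [pow_add, pow_succ]
      field_simp
      ring
  rw [h]
  gcongr
  have : (0:ℝ) ≤ 4/2^m := by positivity
  linarith

lemma second_upper (k : ℕ) (hk0 : 0 < k) (n L J : ℕ) (hJ : n < 2^J) (hL : L ≤ J) :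
    ∑ μ : Nat.Partition n, (Msum 2 k μ.parts : ℝ)^2 ≤
      (L:ℝ)^2 * uu n + 2 * J * uu n + 2 * J * (4/2^L * psum uu n) := by
  have hz : 0 ≤ psum uu n := psum_nonneg (fun n => (uu_pos n).le) n
  have hu := (uu_pos n).le
  have hpos : ∀ j, 0 < k*2^j := fun j => by positivity
  have hdiv : ∀ j : ℕ, (2:ℝ)/((k*2^j:ℕ):ℝ) * psum uu n ≤ 2/2^j * psum uu n := by
    intro j
    apply mul_le_mul_of_nonneg_right _ hz
    apply div_le_div_of_nonneg_left (by norm_num) (by positivity)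
    exact_mod_cast Nat.le_mul_of_pos_left _ hk0
  have hb : ∀ i j : ℕ, ∑ μ : Nat.Partition n,
      (((k*2^i : ℕ) : ℝ) * μ.parts.count (k*2^i)) * (((k*2^j : ℕ) : ℝ) * μ.parts.count (k*2^j)) ≤
      (if i = j then 2 * uu n else 0) + (if i < L then 1 else 0) * (if j < L then 1 else 0) * uu n
      + (if L ≤ i then (2:ℝ)/2^i else 0) * psum uu n + (if L ≤ j then (2:ℝ)/2^j else 0) * psum uu n := by
    intro i j
    have t1 : (0:ℝ) ≤ (if i < L then 1 else 0) * (if j < L then 1 else 0) * uu n := by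
      split_ifs <;> simp [hu]
    have t2 : ∀ i, (0:ℝ) ≤ (if L ≤ i then (2:ℝ)/2^i else 0) * psum uu n := by
      intro i; split_ifs
      · positivity
      · simp
    by_cases hij : i = j
    · subst hij
      rw [if_pos rfl]
      have := diag_bound n (k*2^i) (hpos i)
      change _ ≤ 2 * uu n at this
      linarith [t2 i]
    · have hne : k*2^i ≠ k*2^j := fun hab => hij
        (Nat.pow_right_injective le_rfl (Nat.eq_of_mul_eq_mul_left hk0 hab))
      rw [if_neg hij]
      by_cases hi : L ≤ i
      · have h1 := (pair_bound2 n _ _ (hpos i) (hpos j) hne).trans (hdiv i)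
        have h2 := t2 j
        rw [if_pos hi]
        linarith
      · by_cases hj : L ≤ j
        · have h1 := (pair_bound2 n _ _ (hpos j) (hpos i) hne.symm).trans (hdiv j)
          have h2 := t2 i
          rw [if_pos hj]
          simp only [mul_comm (((k*2^j : ℕ) : ℝ) * _)] at h1
          linarith
        · have h1 := pair_bound1 n _ _ (hpos i) (hpos j) hne
          change _ ≤ uu n at h1
          rw [if_neg hi, if_neg hj, if_pos (by omega), if_pos (by omega)]
          linarith
  have e : ∑ μ : Nat.Partition n, (Msum 2 k μ.parts : ℝ)^2 =
     ∑ i ∈ Finset.range J, ∑ j ∈ Finset.range J, ∑ μ : Nat.Partition n,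
      (((k*2^i : ℕ) : ℝ) * μ.parts.count (k*2^i)) * (((k*2^j : ℕ) : ℝ) * μ.parts.count (k*2^j)) := by
    rw [Finset.sum_congr rfl fun μ _ => by
      rw [Msum_eq k hk0 n J hJ μ, sq, Finset.sum_mul_sum], Finset.sum_comm]
    apply Finset.sum_congr rfl
    intro i _
    rw [Finset.sum_comm]
  rw [e]
  refine (Finset.sum_le_sum fun i _ => Finset.sum_le_sum fun j _ => hb i j).trans ?_
  simp only [Finset.sum_add_distrib]
  have hg : ∑ j ∈ Finset.range J, (if L ≤ j then (2:ℝ)/2^j else 0) ≤ 4/2^L := by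
    have := geom_tail L (J-L)
    rwa [Nat.add_sub_cancel' hL] at this
  have hg2 := mul_le_mul_of_nonneg_right hg hz
  have hc : ∑ j ∈ Finset.range J, (if j < L then (1:ℝ) else 0) = L := by
    rw [← Finset.sum_filter]
    have : (Finset.range J).filter (fun j => j < L) = Finset.range L := by
      ext j; simp; omega
    rw [this]; simp
  have s1 : ∑ i ∈ Finset.range J, ∑ j ∈ Finset.range J, (if i = j then 2 * uu n else 0)
      = 2 * J * uu n := by
    rw [Finset.sum_congr rfl (fun i hi => by
      rw [Finset.sum_ite_eq, if_pos hi] :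
      ∀ i ∈ Finset.range J, ∑ j ∈ Finset.range J, (if i = j then 2 * uu n else 0) = 2 * uu n)]
    simp; ring
  have s2 : ∑ i ∈ Finset.range J, ∑ j ∈ Finset.range J,
      (if i < L then (1:ℝ) else 0) * (if j < L then 1 else 0) * uu n = (L:ℝ)^2 * uu n := by
    simp only [← Finset.sum_mul]
    rw [← Finset.sum_mul_sum, hc, sq]
  have s3 : ∑ i ∈ Finset.range J, ∑ j ∈ Finset.range J,
      (if L ≤ i then (2:ℝ)/2^i else 0) * psum uu n ≤ J * (4/2^L * psum uu n) := by
    simp only [Finset.sum_const, Finset.card_range, nsmul_eq_mul]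
    rw [← Finset.mul_sum, ← Finset.sum_mul]
    exact mul_le_mul_of_nonneg_left hg2 (by positivity)
  have s4 : ∑ i ∈ Finset.range J, ∑ j ∈ Finset.range J,
      (if L ≤ j then (2:ℝ)/2^j else 0) * psum uu n ≤ J * (4/2^L * psum uu n) := by
    simp only [Finset.sum_const, Finset.card_range, nsmul_eq_mul]
    rw [← Finset.sum_mul]
    exact mul_le_mul_of_nonneg_left hg2 (by positivity)
  rw [s1, s2]
  linarith

lemma first_lower (k : ℕ) (hk0 : 0 < k) (n L J : ℕ) (hJ : n < 2^J) (hL : L ≤ J) :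
    (L:ℝ) * vv n - k * 2^L * pp n ≤ ∑ μ : Nat.Partition n, (Msum 2 k μ.parts : ℝ) := by
  rw [Finset.sum_congr rfl fun μ _ => Msum_eq k hk0 n J hJ μ, Finset.sum_comm]
  have h1 : ∑ j ∈ Finset.range L, ∑ μ : Nat.Partition n,
      (((k*2^j : ℕ) : ℝ) * μ.parts.count (k*2^j)) ≤ ∑ j ∈ Finset.range J, ∑ μ : Nat.Partition n,
      (((k*2^j : ℕ) : ℝ) * μ.parts.count (k*2^j)) :=
    Finset.sum_le_sum_of_subset_of_nonneg (Finset.range_mono hL) fun i _ _ =>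
      Finset.sum_nonneg fun μ _ => by positivity
  refine le_trans ?_ h1
  refine le_trans ?_ (Finset.sum_le_sum fun j _ => single_lower n (k*2^j) (by positivity))
  rw [Finset.sum_sub_distrib, ← Finset.sum_mul]
  have h2 : ∑ j ∈ Finset.range L, ((k*2^j:ℕ):ℝ) ≤ k * 2^L := by
    push_cast
    rw [← Finset.mul_sum, geom_sum_eq (by norm_num)]
    apply mul_le_mul_of_nonneg_left _ (by positivity)
    norm_num
  have h3 := mul_le_mul_of_nonneg_right h2 (pp_nonneg n)
  simp only [Finset.sum_const, Finset.card_range, nsmul_eq_mul]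
  change _ ≤ (L:ℝ) * vv n - _
  linarith

lemma card_pp (n : ℕ) : (Nat.card (Nat.Partition n) : ℝ) = pp n := by
  rw [Nat.card_eq_fintype_card]; rfl

lemma log_bounds (n : ℕ) (hn : 0 < n) :
    (2:ℝ)^(Nat.log 4 n) ≤ Real.sqrt n ∧ Real.sqrt n ≤ 2 * 2^(Nat.log 4 n) ∧
    n < 2^(2 * Nat.log 4 n + 2) := by
  have h1 : 4^(Nat.log 4 n) ≤ n := Nat.pow_log_le_self 4 hn.ne'
  have h2 : n < 4^(Nat.log 4 n + 1) := Nat.lt_pow_succ_log_self (by norm_num) n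
  refine ⟨?_, ?_, ?_⟩
  · apply Real.le_sqrt_of_sq_le
    rw [← pow_mul, mul_comm, pow_mul]
    norm_num
    exact_mod_cast h1
  · apply Real.sqrt_le_iff.2 ⟨by positivity, ?_⟩
    rw [mul_pow, ← pow_mul, mul_comm _ 2, pow_mul]
    norm_num
    rw [pow_succ, mul_comm] at h2
    exact_mod_cast h2.le
  · rw [show 2 * Nat.log 4 n + 2 = 2 * (Nat.log 4 n + 1) by ring, pow_mul]
    exact h2

lemma L_tendsto : Tendsto (fun n : ℕ => (Nat.log 4 n : ℝ) / Real.log n) atTop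
    (nhds (1 / (2 * Real.log 2))) := by
  have hlog : Tendsto (fun n : ℕ => Real.log n) atTop atTop :=
    Real.tendsto_log_atTop.comp tendsto_natCast_atTop_atTop
  have hl2 : 0 < Real.log 2 := Real.log_pos (by norm_num)
  have h4 : Real.log 4 = 2 * Real.log 2 := by
    rw [show (4:ℝ) = 2^2 by norm_num, Real.log_pow]; norm_num
  have hlo : Tendsto (fun n : ℕ => 1 / (2 * Real.log 2) - (Real.log n)⁻¹) atTop
    (nhds (1 / (2 * Real.log 2))) := by
    have := hlog.inv_tendsto_atTop.const_sub (1 / (2 * Real.log 2))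
    simpa using this
  refine tendsto_of_tendsto_of_tendsto_of_le_of_le' hlo tendsto_const_nhds ?_ ?_
  · filter_upwards [hlog.eventually_gt_atTop 0, eventually_gt_atTop 0] with n hn h0
    have h2 : n < 4^(Nat.log 4 n + 1) := Nat.lt_pow_succ_log_self (by norm_num) n
    have h3 : Real.log n ≤ (Nat.log 4 n + 1) * (2 * Real.log 2) := by
      rw [← h4]
      have : (n:ℝ) ≤ 4^(Nat.log 4 n + 1) := by exact_mod_cast h2.le
      have := Real.log_le_log (by exact_mod_cast h0) this
      rw [Real.log_pow] at this
      exact_mod_cast this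
    rw [le_div_iff₀ hn, sub_mul, inv_mul_cancel₀ hn.ne', one_div_mul_eq_div, sub_le_iff_le_add,
      div_le_iff₀ (by positivity)]
    exact h3
  · filter_upwards [hlog.eventually_gt_atTop 0, eventually_gt_atTop 0] with n hn h0
    have h2 : 4^(Nat.log 4 n) ≤ n := Nat.pow_log_le_self 4 h0.ne'
    have h3 : Nat.log 4 n * (2 * Real.log 2) ≤ Real.log n := by
      rw [← h4]
      have : (4:ℝ)^(Nat.log 4 n) ≤ n := by exact_mod_cast h2
      have := Real.log_le_log (by positivity) this
      rwa [Real.log_pow] at this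
    rw [div_le_div_iff₀ hn (by positivity)]
    linarith

/-- the normalisation -/
noncomputable def DD (n : ℕ) : ℝ :=
  Real.sqrt 6 / (2 * π * Real.log 2) * Real.sqrt n * Real.log n

lemma DD_pos {n : ℕ} (hn : 2 ≤ n) : 0 < DD n := by
  have h1 : (1:ℝ) < n := by exact_mod_cast hn
  have := Real.log_pos h1
  have := Real.log_pos (show (1:ℝ) < 2 by norm_num)
  unfold DD
  positivity

lemma exists_lower (k : ℕ) (hk0 : 0 < k) : ∃ lo : ℕ → ℝ, Tendsto lo atTop (nhds 1) ∧
    ∀ᶠ n in atTop, lo n ≤ pAvg n (fun μ => (Msum 2 k μ.parts : ℝ)) / DD n := by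
  have hl2 : 0 < Real.log 2 := Real.log_pos (by norm_num)
  have hlog : Tendsto (fun n : ℕ => Real.log n) atTop atTop :=
    Real.tendsto_log_atTop.comp tendsto_natCast_atTop_atTop
  refine ⟨fun n => (vv n / (pp n * Real.sqrt n) * ((Nat.log 4 n : ℝ) / Real.log n)
    - k * (Real.log n)⁻¹) * (2 * π * Real.log 2 / Real.sqrt 6), ?_, ?_⟩
  · have h := ((vv_pp.mul L_tendsto).sub (hlog.inv_tendsto_atTop.const_mul (k:ℝ))).mul_const
      (2 * π * Real.log 2 / Real.sqrt 6)
    have e : (Real.sqrt 6 / π * (1 / (2 * Real.log 2)) - k * 0) *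
      (2 * π * Real.log 2 / Real.sqrt 6) = 1 := by
      have : Real.sqrt 6 ≠ 0 := by positivity
      field_simp; simp
    rw [e] at h
    exact h
  · filter_upwards [eventually_ge_atTop 2] with n hn
    have hD := DD_pos hn
    have hn' : (1:ℝ) < n := by exact_mod_cast hn
    have hlp := Real.log_pos hn'
    obtain ⟨b1, b2, b3⟩ := log_bounds n (by omega)
    have h := first_lower k hk0 n (Nat.log 4 n) _ b3 (by omega)
    have hp : 0 < pp n := by linarith [pp_pos n]
    have hs : 0 < Real.sqrt n := Real.sqrt_pos.2 (by linarith)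
    rw [pAvg, card_pp, le_div_iff₀ hD, le_div_iff₀ hp]
    refine le_trans ?_ h
    have e : (vv n / (pp n * Real.sqrt n) * ((Nat.log 4 n : ℝ) / Real.log n)
      - k * (Real.log n)⁻¹) * (2 * π * Real.log 2 / Real.sqrt 6) * DD n * pp n =
      (Nat.log 4 n : ℝ) * vv n - k * Real.sqrt n * pp n := by
      unfold DD
      have : Real.sqrt 6 ≠ 0 := by positivity
      field_simp
    rw [e]
    have := mul_le_mul_of_nonneg_right (mul_le_mul_of_nonneg_left b1
      (show (0:ℝ) ≤ k by positivity)) hp.le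
    linarith

lemma exists_upper (k : ℕ) (hk0 : 0 < k) : ∃ hi : ℕ → ℝ, Tendsto hi atTop (nhds 1) ∧
    ∀ᶠ n in atTop, pAvg n (fun μ => (Msum 2 k μ.parts : ℝ)^2) / DD n ^ 2 ≤ hi n := by
  have hl2 : 0 < Real.log 2 := Real.log_pos (by norm_num)
  have hlog : Tendsto (fun n : ℕ => Real.log n) atTop atTop :=
    Real.tendsto_log_atTop.comp tendsto_natCast_atTop_atTop
  have h60 : Real.sqrt 6 ≠ 0 := by positivity
  have h6 : Real.sqrt 6 ^ 2 = 6 := Real.sq_sqrt (by norm_num)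
  obtain ⟨C, hC0, hC⟩ := zz_le
  refine ⟨fun n => uu n / (n * pp n) * (((Nat.log 4 n : ℝ) / Real.log n)^2
    + (4 + 64 * C) * (((Nat.log 4 n : ℝ) / Real.log n) * (Real.log n)⁻¹ + (Real.log n)⁻¹ ^ 2))
    * (2 * π * Real.log 2 / Real.sqrt 6)^2, ?_, ?_⟩
  · have hi := hlog.inv_tendsto_atTop
    have h := (inv_alpha.mul ((L_tendsto.pow 2).add
      (((L_tendsto.mul hi).add (hi.pow 2)).const_mul (4 + 64 * C)))).mul_const
      ((2 * π * Real.log 2 / Real.sqrt 6)^2)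
    have e : (π^2/6)⁻¹ * ((1 / (2 * Real.log 2))^2 + (4 + 64 * C) *
      (1 / (2 * Real.log 2) * 0 + 0^2)) * (2 * π * Real.log 2 / Real.sqrt 6)^2 = 1 := by
      rw [div_pow _ (Real.sqrt 6), h6]
      field_simp; ring
    rw [e] at h
    exact h
  · filter_upwards [eventually_ge_atTop 2] with n hn
    have hD := DD_pos hn
    have hn' : (1:ℝ) < n := by exact_mod_cast hn
    have hlp := Real.log_pos hn'
    obtain ⟨b1, b2, b3⟩ := log_bounds n (by omega)
    have h := second_upper k hk0 n (Nat.log 4 n) _ b3 (by omega)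
    have hp : 0 < pp n := by linarith [pp_pos n]
    have hu := uu_pos n
    have hs1 : 1 ≤ Real.sqrt n := Real.one_le_sqrt.2 hn'.le
    have hs2 : Real.sqrt n ^ 2 = n := Real.sq_sqrt (by linarith)
    have hz : (4:ℝ)/2^(Nat.log 4 n) * psum uu n ≤ 16 * C * uu n := by
      have hL : (0:ℝ) < 2^(Nat.log 4 n) := by positivity
      rw [div_mul_eq_mul_div, div_le_iff₀ hL]
      have h1 := hC n
      have h2 : C * (Real.sqrt n + 1) * uu n ≤ C * (4 * 2^(Nat.log 4 n)) * uu n := by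
        gcongr
        linarith
      nlinarith
    have hz2 := mul_le_mul_of_nonneg_left hz
      (show (0:ℝ) ≤ 2 * ((2 * Nat.log 4 n + 2 : ℕ) : ℝ) by positivity)
    rw [pAvg, card_pp, div_le_iff₀ (by positivity), div_le_iff₀ hp]
    refine h.trans ?_
    have e : uu n / (n * pp n) * (((Nat.log 4 n : ℝ) / Real.log n)^2
      + (4 + 64 * C) * (((Nat.log 4 n : ℝ) / Real.log n) * (Real.log n)⁻¹ + (Real.log n)⁻¹ ^ 2))
      * (2 * π * Real.log 2 / Real.sqrt 6)^2 * DD n ^ 2 * pp n =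
      uu n * ((Nat.log 4 n : ℝ)^2 + (4 + 64 * C) * (Nat.log 4 n + 1)) := by
      have e1 : DD n ^ 2 = (Real.sqrt 6 / (2 * π * Real.log 2))^2 * n * Real.log n ^ 2 := by
        unfold DD; rw [mul_pow, mul_pow, hs2]
      rw [e1]
      field_simp
    rw [e]
    push_cast at hz2 ⊢
    linarith

lemma var_eq (n : ℕ) (f : Nat.Partition n → ℝ) :
    pAvg n (fun μ => (f μ - pAvg n f)^2) = pAvg n (fun μ => f μ ^ 2) - pAvg n f ^ 2 := by
  have hp : 0 < pp n := by linarith [pp_pos n]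
  have h1 : ∑ μ, f μ = pp n * pAvg n f := by
    rw [pAvg, card_pp]; field_simp
  have h2 : ∀ m : ℝ, ∑ μ, (f μ - m)^2 = ∑ μ, f μ ^ 2 - 2 * m * ∑ μ, f μ + pp n * m^2 := by
    intro m
    have : pp n * m^2 = ∑ μ : Nat.Partition n, m^2 := by simp [pp]
    rw [this, Finset.mul_sum, ← Finset.sum_sub_distrib, ← Finset.sum_add_distrib]
    apply Finset.sum_congr rfl; intro μ _; ring
  have h3 : ∑ μ, f μ ^ 2 = pp n * pAvg n (fun μ => f μ ^ 2) := by
    rw [pAvg, card_pp]; field_simp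
  generalize pAvg n f = m at *
  rw [pAvg, h2, h1, h3, card_pp]
  field_simp
  ring

lemma var_nonneg (n : ℕ) (f : Nat.Partition n → ℝ) (m : ℝ) :
    0 ≤ pAvg n (fun μ => (f μ - m)^2) :=
  div_nonneg (Finset.sum_nonneg fun μ _ => sq_nonneg _) (by positivity)

lemma cheb (n : ℕ) (f : Nat.Partition n → ℝ) (m t d : ℝ) (hd : 0 ≤ d) (ht : t + d ≤ m) :
    (Nat.card {μ : Nat.Partition n // f μ < t} : ℝ) / Nat.card (Nat.Partition n) * d^2 ≤
      pAvg n (fun μ => (f μ - m)^2) := by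
  classical
  rw [pAvg, div_mul_eq_mul_div]
  apply div_le_div_of_nonneg_right _ (by positivity)
  rw [Nat.card_eq_fintype_card, Fintype.card_subtype, ← nsmul_eq_mul, ← Finset.sum_const,
    Finset.sum_filter]
  apply Finset.sum_le_sum
  intro μ _
  split_ifs with h
  · nlinarith
  · positivity

/-- For `p = 2` and fixed odd `k`:
`E_{μ⊢n}(M_μ^{(k)})² = ((√6/(2π log 2))√n log n)²(1+o(1))`; consequently the variance of
`M_μ^{(k)}` is `o((√n log n)²)` and, by Chebyshev, all but an `o(1)`-proportion of the
partitions `μ` of `n` satisfy `M_μ^{(k)} ≥ (1/log 2 - 1/100)(√6/(2π))√n log n`. -/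
theorem secondMoment_Msum (k : ℕ) (hk0 : 0 < k) (hk : Odd k) :
    Tendsto
      (fun n : ℕ =>
        pAvg n (fun μ => (Msum 2 k μ.parts : ℝ) ^ 2) /
          (Real.sqrt 6 / (2 * π * Real.log 2) * Real.sqrt n * Real.log n) ^ 2)
      atTop (nhds 1) ∧
    Tendsto
      (fun n : ℕ =>
        pAvg n (fun μ => ((Msum 2 k μ.parts : ℝ) -
            pAvg n (fun μ' => (Msum 2 k μ'.parts : ℝ))) ^ 2) /
          (Real.sqrt n * Real.log n) ^ 2)
      atTop (nhds 0) ∧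
    Tendsto
      (fun n : ℕ =>
        (Nat.card {μ : Nat.Partition n //
            (Msum 2 k μ.parts : ℝ) <
              (1 / Real.log 2 - 1 / 100) * (Real.sqrt 6 / (2 * π)) *
                Real.sqrt n * Real.log n} : ℝ) /
          Nat.card (Nat.Partition n))
      atTop (nhds 0) := by
  have hl2 : 0 < Real.log 2 := Real.log_pos (by norm_num)
  have hl2' : Real.log 2 < 1 := by linarith [Real.log_two_lt_d9]
  obtain ⟨lo, hlo, hlo'⟩ := exists_lower k hk0
  obtain ⟨hi, hhi, hhi'⟩ := exists_upper k hk0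
  have hlo1 := hlo.eventually (eventually_ge_nhds (show (0:ℝ) < 1 by norm_num))
  have hlo2 := hlo.pow 2
  rw [one_pow] at hlo2
  set κ : ℝ := Real.sqrt 6 / (2 * π * Real.log 2) with hκ
  have hκ0 : 0 < κ := by positivity
  have hDD : ∀ n : ℕ, DD n = κ * (Real.sqrt n * Real.log n) := by
    intro n; unfold DD; ring
  have hvar : ∀ n : ℕ, pAvg n (fun μ => ((Msum 2 k μ.parts : ℝ) -
            pAvg n (fun μ' => (Msum 2 k μ'.parts : ℝ))) ^ 2) =
      pAvg n (fun μ => (Msum 2 k μ.parts : ℝ)^2) - pAvg n (fun μ => (Msum 2 k μ.parts : ℝ))^2 :=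
    fun n => var_eq n _
  have hvar0 : ∀ n : ℕ, 0 ≤ pAvg n (fun μ => ((Msum 2 k μ.parts : ℝ) -
            pAvg n (fun μ' => (Msum 2 k μ'.parts : ℝ))) ^ 2) := fun n => var_nonneg n _ _
  have hsq : ∀ᶠ n in atTop, lo n ^ 2 ≤ pAvg n (fun μ => (Msum 2 k μ.parts : ℝ))^2 / DD n ^ 2 := by
    filter_upwards [hlo1, hlo'] with n h1 h2
    rw [← div_pow]
    gcongr
  have hV : Tendsto (fun n : ℕ => pAvg n (fun μ => ((Msum 2 k μ.parts : ℝ) -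
            pAvg n (fun μ' => (Msum 2 k μ'.parts : ℝ))) ^ 2) /
          (Real.sqrt n * Real.log n) ^ 2) atTop (nhds 0) := by
    have h := (hhi.sub hlo2).const_mul (κ^2)
    rw [sub_self, mul_zero] at h
    refine squeeze_zero' (Eventually.of_forall fun n => div_nonneg (hvar0 n) (by positivity)) ?_ h
    filter_upwards [hsq, hhi', eventually_ge_atTop 2] with n h1 h2 hn
    have hD := DD_pos hn
    have e : (Real.sqrt n * Real.log n)^2 = DD n ^ 2 / κ^2 := by
      rw [hDD]; field_simp
    rw [e, hvar, ← div_mul, mul_comm, sub_div]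
    gcongr
  refine ⟨?_, hV, ?_⟩
  · refine tendsto_of_tendsto_of_tendsto_of_le_of_le' hlo2 hhi ?_ hhi'
    filter_upwards [hsq] with n h1
    refine h1.trans ?_
    apply div_le_div_of_nonneg_right _ (by positivity)
    have := hvar0 n
    rw [hvar] at this
    linarith
  · set δ : ℝ := Real.log 2 / 200 with hδ
    have hδ0 : 0 < δ := by positivity
    have h := hV.mul_const (1 / (δ * κ)^2)
    rw [zero_mul] at h
    refine squeeze_zero' (Eventually.of_forall fun n => by positivity) ?_ h
    have hlo3 := hlo.eventually (eventually_ge_nhds (show 1 - δ < 1 by linarith))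
    filter_upwards [hlo3, hlo', eventually_ge_atTop 2] with n h1 h2 hn
    have hD := DD_pos hn
    have h3 := h1.trans h2
    rw [le_div_iff₀ hD] at h3
    have et : (1 / Real.log 2 - 1 / 100) * (Real.sqrt 6 / (2 * π)) * Real.sqrt n * Real.log n
        = (1 - 2 * δ) * DD n := by
      rw [hDD, hκ, hδ]; field_simp; ring
    have hc := cheb n (fun μ => (Msum 2 k μ.parts : ℝ))
      (pAvg n (fun μ' => (Msum 2 k μ'.parts : ℝ)))
      ((1 / Real.log 2 - 1 / 100) * (Real.sqrt 6 / (2 * π)) * Real.sqrt n * Real.log n)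
      (δ * DD n) (by positivity) (by rw [et]; linarith)
    have hs : 0 < (Real.sqrt n * Real.log n) := by
      rw [hDD] at hD
      exact pos_of_mul_pos_right hD hκ0.le
    rw [← div_le_div_iff_of_pos_right (show 0 < (δ * DD n)^2 by positivity),
      mul_div_assoc, div_self (by positivity), mul_one] at hc
    refine hc.trans (le_of_eq ?_)
    rw [hDD]
    field_simp
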